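/- Let Ω, Ω' ⊆ ℝⁿ be open, F : Ω → Ω' a C² diffeomorphism, A : Ω → (n×n real matrices) a C¹ matrix field, κ : Ω → ℝ positive, and S : Ω × [0,∞) → ℝ. Suppose ψ : Ω × [0,∞) → ℝ is C¹ in t, C² in x, and solves κ(x)⁻¹ ∂_t ψ(x,t) = ∇_x·(A∇_x ψ)(x,t) + S(x,t) for all x ∈ Ω and t ≥ 0. Define ψ̃(y,t) := ψ(F⁻¹(y),t), κ̃(y) := |det DF(F⁻¹(y))| κ(F⁻¹(y)), Ã := F_*A, and S̃(y,t) := |det DF(F⁻¹(y))|⁻¹ S(F⁻¹(y),t). Then κ̃(y)⁻¹ ∂_t ψ̃(y,t) = ∇_y·(Ã∇_y ψ̃)(y,t) + S̃(y,t) for all y ∈ Ω' and t ≥ 0. -/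

import Mathlib

open Matrix

/-- The gradient of `u : ℝⁿ → ℝ`, as the vector of partial derivatives. -/
noncomputable def pgrad {n : ℕ} (u : (Fin n → ℝ) → ℝ) (x : Fin n → ℝ) : Fin n → ℝ :=
  fun j => fderiv ℝ u x (Pi.single j 1)

/-- The Jacobian matrix `DF = (∂F_i/∂x_j)` of `F : ℝⁿ → ℝⁿ`. -/
noncomputable def jac {n : ℕ} (F : (Fin n → ℝ) → (Fin n → ℝ)) (x : Fin n → ℝ) :
    Matrix (Fin n) (Fin n) ℝ :=
  Matrix.of fun i j => fderiv ℝ (fun y => F y i) x (Pi.single j 1)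

/-- The divergence `∇·V = Σ_j ∂V_j/∂x_j` of a vector field `V : ℝⁿ → ℝⁿ`. -/
noncomputable def pdiv {n : ℕ} (V : (Fin n → ℝ) → (Fin n → ℝ)) (x : Fin n → ℝ) : ℝ :=
  ∑ j, fderiv ℝ (fun y => V y j) x (Pi.single j 1)

/-- The pushforward `F_*A(y) = (DF A DFᵀ)/|det DF| ∘ F⁻¹(y)`, where `G` is the inverse of `F`. -/
noncomputable def pushf {n : ℕ} (F G : (Fin n → ℝ) → (Fin n → ℝ))
    (A : (Fin n → ℝ) → Matrix (Fin n) (Fin n) ℝ) (y : Fin n → ℝ) :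
    Matrix (Fin n) (Fin n) ℝ :=
  |(jac F (G y)).det|⁻¹ • (jac F (G y) * A (G y) * (jac F (G y))ᵀ)

/-- Jacobi's formula for the derivative of the determinant at an invertible matrix `M x`
with inverse `B`. -/
theorem Matrix.hasFDerivAt_det {m E : Type*} [Fintype m] [DecidableEq m]
    [NormedAddCommGroup E] [NormedSpace ℝ E] {M : E → Matrix m m ℝ} {x : E}
    (hM : ∀ i j, DifferentiableAt ℝ (fun z => M z i j) x) {B : Matrix m m ℝ} (hB : B * M x = 1) :
    HasFDerivAt (fun z => (M z).det)
      ((M x).det • ∑ i, ∑ j, B i j • fderiv ℝ (fun z => M z j i) x) x := by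
  let D : (m → m → ℝ) → ℝ := fun a => (Matrix.of a).det
  have hD : Differentiable ℝ D := by
    simp only [D, Matrix.det_apply, Matrix.of_apply]
    fun_prop
  let M₀ : m → m → ℝ := M x
  have hDN (N : m → m → ℝ) : fderiv ℝ D (M x) N = (M x).det * (B * Matrix.of N).trace := by
    have h1 : HasDerivAt (fun t : ℝ => D (M₀ + t • N)) (fderiv ℝ D (M x) N) 0 :=
      (hD (M x)).hasFDerivAt.hasLineDerivAt N
    have h2 : (fun t : ℝ => D (M₀ + t • N)) = fun t : ℝ =>
        (M x).det * (1 + t • (B * Matrix.of N)).det := by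
      funext t
      rw [← Matrix.det_mul, mul_add, mul_one, mul_smul_comm, ← mul_assoc, mul_eq_one_comm.mp hB,
        one_mul]
      rfl
    have h3 : HasDerivAt (fun t : ℝ => (M x).det * (1 + t • (B * Matrix.of N)).det)
        ((M x).det * (B * Matrix.of N).trace) 0 := by
      apply HasDerivAt.const_mul
      set p : Polynomial ℝ :=
        (1 + (Polynomial.X : Polynomial ℝ) • (B * Matrix.of N).map Polynomial.C).det with hp
      have hpe : (fun t : ℝ => (1 + t • (B * Matrix.of N)).det) = fun t => p.eval t := by
        funext t
        rw [hp, ← Polynomial.coe_evalRingHom, RingHom.map_det]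
        congr 1
        ext i j
        simp [-Matrix.map_mul, Matrix.one_apply, apply_ite (Polynomial.eval t), mul_comm t]
      rw [hpe, ← Matrix.derivative_det_one_add_X_smul]
      exact p.hasDerivAt 0
    rw [h2] at h1
    exact h1.unique h3
  have hMx : HasFDerivAt (fun z i j => M z i j)
      (ContinuousLinearMap.pi fun i => ContinuousLinearMap.pi fun j =>
        fderiv ℝ (fun z => M z i j) x) x :=
    hasFDerivAt_pi.2 fun i => hasFDerivAt_pi.2 fun j => (hM i j).hasFDerivAt
  have hc := (hD (M x)).hasFDerivAt.comp x hMx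
  refine hc.congr_fderiv ?_
  ext v
  simp [hDN, Matrix.trace, Matrix.mul_apply]

theorem HasFDerivAt.abs_inv_of_smul {E : Type*} [NormedAddCommGroup E] [NormedSpace ℝ E]
    {d : E → ℝ} {x : E} {L : E →L[ℝ] ℝ} (h : HasFDerivAt d (d x • L) x) (hd : d x ≠ 0) :
    HasFDerivAt (fun z => |d z|⁻¹) (-(|d x|⁻¹ • L)) x := by
  refine ((hasDerivAt_inv (abs_ne_zero.2 hd)).comp_hasFDerivAt x (h.abs hd)).congr_fderiv ?_
  have hcoef : -(|d x| ^ 2)⁻¹ * (SignType.sign (d x) * d x) = -|d x|⁻¹ := by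
    have := abs_ne_zero.2 hd
    rw [sign_mul_self]
    field_simp
  rw [smul_smul, smul_smul, mul_assoc, hcoef]
  exact neg_smul _ _

theorem fderiv_apply_eq_sum {n : ℕ} (L : (Fin n → ℝ) →L[ℝ] ℝ) (v : Fin n → ℝ) :
    L v = ∑ k, v k * L (Pi.single k 1) := by
  conv_lhs => rw [pi_eq_sum_univ' v]
  simp [map_sum]

theorem pgrad_comp {n : ℕ} {u : (Fin n → ℝ) → ℝ} {F : (Fin n → ℝ) → (Fin n → ℝ)} {x : Fin n → ℝ}
    (hu : DifferentiableAt ℝ u (F x)) (hF : DifferentiableAt ℝ F x) :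
    pgrad (fun z => u (F z)) x = (jac F x)ᵀ *ᵥ pgrad u (F x) := by
  funext j
  have h : fderiv ℝ (fun z => u (F z)) x = (fderiv ℝ u (F x)).comp (fderiv ℝ F x) :=
    fderiv_comp x hu hF
  simp only [pgrad, h, ContinuousLinearMap.comp_apply]
  rw [fderiv_apply_eq_sum]
  simp [Matrix.mulVec, dotProduct, jac, fderiv_apply hF, pgrad]

theorem jac_comp {n : ℕ} {F G : (Fin n → ℝ) → (Fin n → ℝ)} {y : Fin n → ℝ}
    (hF : DifferentiableAt ℝ F (G y)) (hG : DifferentiableAt ℝ G y) :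
    jac (fun z => F (G z)) y = jac F (G y) * jac G y := by
  ext i j
  have := congrFun (pgrad_comp (u := fun z => F z i) (by fun_prop) hG) j
  simpa [pgrad, jac, Matrix.mulVec, dotProduct, Matrix.mul_apply, mul_comm] using this

theorem jac_mul_jac_of_inverse {n : ℕ} {F G : (Fin n → ℝ) → (Fin n → ℝ)} {y : Fin n → ℝ}
    (hF : DifferentiableAt ℝ F (G y)) (hG : DifferentiableAt ℝ G y)
    (h : ∀ᶠ z in nhds y, F (G z) = z) : jac F (G y) * jac G y = 1 := by
  rw [← jac_comp hF hG]
  ext i j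
  have hi : (fun z => F (G z) i) =ᶠ[nhds y] fun z => z i := by
    filter_upwards [h] with z hz
    rw [hz]
  simp [jac, hi.fderiv_eq, fderiv_apply, Matrix.one_apply, Pi.single_apply]

theorem pdiv_comp {n : ℕ} {V G : (Fin n → ℝ) → (Fin n → ℝ)} {y : Fin n → ℝ}
    (hV : DifferentiableAt ℝ V (G y)) (hG : DifferentiableAt ℝ G y) :
    pdiv (fun z => V (G z)) y = (jac V (G y) * jac G y).trace := by
  rw [← jac_comp hV hG]
  rfl

theorem fderiv_jac_symm {n : ℕ} {F : (Fin n → ℝ) → (Fin n → ℝ)} {x : Fin n → ℝ}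
    (hF : ContDiffAt ℝ 2 F x) (i j k : Fin n) :
    fderiv ℝ (fun z => jac F z i j) x (Pi.single k 1) =
      fderiv ℝ (fun z => jac F z i k) x (Pi.single j 1) := by
  have hi : ContDiffAt ℝ 2 (fun z => F z i) x := contDiffAt_pi.1 hF i
  have hd : DifferentiableAt ℝ (fderiv ℝ (fun z => F z i)) x :=
    (hi.fderiv_right (m := 1) (by norm_num)).differentiableAt one_ne_zero
  have h (a b : Fin n) : fderiv ℝ (fun z => jac F z i a) x (Pi.single b 1) =
      fderiv ℝ (fderiv ℝ (fun z => F z i)) x (Pi.single b 1) (Pi.single a 1) := by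
    simp only [jac, Matrix.of_apply]
    rw [fderiv_clm_apply hd (differentiableAt_const _)]
    simp
  rw [h, h]
  exact (hi.isSymmSndFDerivAt (by simp)).eq _ _

theorem differentiableAt_jac {n : ℕ} {F : (Fin n → ℝ) → (Fin n → ℝ)} {x : Fin n → ℝ}
    (hF : ContDiffAt ℝ 2 F x) (i j : Fin n) : DifferentiableAt ℝ (fun z => jac F z i j) x := by
  have hi : ContDiffAt ℝ 2 (fun z => F z i) x := contDiffAt_pi.1 hF i
  have hd : DifferentiableAt ℝ (fderiv ℝ (fun z => F z i)) x :=
    (hi.fderiv_right (m := 1) (by norm_num)).differentiableAt one_ne_zero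
  simp only [jac, Matrix.of_apply]
  fun_prop

/-- The Piola identity: the divergence of the Piola transform of `V`. -/
theorem pdiv_piola {n : ℕ} {F G V : (Fin n → ℝ) → (Fin n → ℝ)} {y : Fin n → ℝ}
    (hF : ContDiffAt ℝ 2 F (G y)) (hG : DifferentiableAt ℝ G y)
    (h : ∀ᶠ z in nhds y, F (G z) = z) (hV : DifferentiableAt ℝ V (G y)) :
    pdiv (fun z => |(jac F (G z)).det|⁻¹ • (jac F (G z) *ᵥ V (G z))) y =
      |(jac F (G y)).det|⁻¹ * pdiv V (G y) := by
  have hPB := jac_mul_jac_of_inverse (hF.differentiableAt two_ne_zero) hG h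
  set x := G y
  set B := jac G y
  set P := jac F x with hP
  have hBP : B * P = 1 := mul_eq_one_comm.mp hPB
  have hdet : P.det ≠ 0 := fun h0 => by simpa [h0] using congrArg Matrix.det hPB
  have hM := differentiableAt_jac hF
  have hc : HasFDerivAt (fun z => |(jac F z).det|⁻¹)
      (-(|P.det|⁻¹ • ∑ a, ∑ b, B a b • fderiv ℝ (fun z => jac F z b a) x)) x :=
    (Matrix.hasFDerivAt_det hM hBP).abs_inv_of_smul hdet
  have hVj (j) : DifferentiableAt ℝ (fun z => V z j) x := by fun_prop
  have hΦ (i) : HasFDerivAt (fun z => (|(jac F z).det|⁻¹ • (jac F z *ᵥ V z)) i)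
      (|P.det|⁻¹ • (∑ j, (P i j • fderiv ℝ (fun z => V z j) x +
          V x j • fderiv ℝ (fun z => jac F z i j) x)) +
        (P *ᵥ V x) i • -(|P.det|⁻¹ • ∑ a, ∑ b, B a b • fderiv ℝ (fun z => jac F z b a) x)) x :=
    hc.mul (HasFDerivAt.fun_sum (u := Finset.univ) (A := fun j z => jac F z i j * V z j)
      fun j _ => (hM i j).hasFDerivAt.mul (hVj j).hasFDerivAt)
  rw [pdiv_comp (V := fun z => |(jac F z).det|⁻¹ • (jac F z *ᵥ V z))
    (differentiableAt_pi.2 fun i => (hΦ i).differentiableAt) hG]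
  have hj (i k) : jac (fun z => |(jac F z).det|⁻¹ • (jac F z *ᵥ V z)) x i k =
      |P.det|⁻¹ * ((P * jac V x) i k +
        ∑ j, V x j * fderiv ℝ (fun z => jac F z i j) x (Pi.single k 1) -
        (P *ᵥ V x) i * ∑ a, ∑ b, B a b * fderiv ℝ (fun z => jac F z b k) x (Pi.single a 1)) := by
    have := congrArg (fun L => L (Pi.single k 1)) (hΦ i).fderiv
    simp only [jac, Matrix.of_apply] at this ⊢
    rw [this]
    simp only [_root_.add_apply, _root_.smul_apply, _root_.neg_apply,
      _root_.sum_apply, smul_eq_mul, Finset.sum_add_distrib, Matrix.mul_apply,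
      Matrix.of_apply]
    have hs (a b) := fderiv_jac_symm hF b a k
    simp only [jac, Matrix.of_apply] at hs
    simp only [hs]
    ring
  have htr : (P * jac V x * B).trace = pdiv V x := by
    rw [Matrix.trace_mul_comm, ← mul_assoc, hBP, one_mul]
    rfl
  have hBPV : B *ᵥ (P *ᵥ V x) = V x := by
    rw [Matrix.mulVec_mulVec, hBP, Matrix.one_mulVec]
  have hsum : ∑ i, ∑ k, (∑ j, V x j * fderiv ℝ (fun z => jac F z i j) x (Pi.single k 1)) * B k i =
      ∑ k, V x k * ∑ a, ∑ b, B a b * fderiv ℝ (fun z => jac F z b k) x (Pi.single a 1) := by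
    simp only [Finset.sum_mul, Finset.mul_sum]
    calc _ = ∑ i, ∑ j, ∑ k, V x j * fderiv ℝ (fun z => jac F z i j) x (Pi.single k 1) * B k i :=
          Finset.sum_congr rfl fun i _ => Finset.sum_comm
      _ = ∑ j, ∑ i, ∑ k, V x j * fderiv ℝ (fun z => jac F z i j) x (Pi.single k 1) * B k i :=
          Finset.sum_comm
      _ = ∑ j, ∑ k, ∑ i, V x j * fderiv ℝ (fun z => jac F z i j) x (Pi.single k 1) * B k i :=
          Finset.sum_congr rfl fun j _ => Finset.sum_comm
      _ = _ := by simp only [mul_assoc, mul_comm (B _ _)]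
  have hsum' (T : Fin n → ℝ) : ∑ i, ∑ k, (P *ᵥ V x) i * T k * B k i = ∑ k, V x k * T k := by
    conv_rhs => rw [← hBPV]
    rw [Finset.sum_comm]
    refine Finset.sum_congr rfl fun k _ => ?_
    rw [Matrix.mulVec, dotProduct, Finset.sum_mul]
    exact Finset.sum_congr rfl fun i _ => by ring
  rw [← htr]
  change ∑ i, ∑ k, jac (fun z => |(jac F z).det|⁻¹ • (jac F z *ᵥ V z)) x i k * B k i =
    |P.det|⁻¹ * ∑ i, ∑ k, (P * jac V x) i k * B k i
  simp only [hj, mul_assoc |P.det|⁻¹, ← Finset.mul_sum, add_mul, sub_mul, Finset.sum_add_distrib, Finset.sum_sub_distrib,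
    hsum]
  rw [hsum', add_sub_cancel_right]

/-- invariance of the heat equation with source under a C² diffeomorphism:
if `κ⁻¹ ∂_t ψ = ∇·(A∇ψ) + S` on `Ω × [0,∞)`, then with `ψ̃(y,t) = ψ(F⁻¹ y, t)`,
`κ̃ = |det DF ∘ F⁻¹| · (κ ∘ F⁻¹)`, `Ã = F_*A`, `S̃(y,t) = |det DF ∘ F⁻¹|⁻¹ S(F⁻¹ y, t)`,
one has `κ̃⁻¹ ∂_t ψ̃ = ∇·(Ã∇ψ̃) + S̃` on `Ω' × [0,∞)`. -/
theorem stmt4 {n : ℕ} (Ω Ω' : Set (Fin n → ℝ)) (hΩ : IsOpen Ω) (hΩ' : IsOpen Ω')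
    (F G : (Fin n → ℝ) → (Fin n → ℝ))
    (hF : ContDiffOn ℝ 2 F Ω) (hG : ContDiffOn ℝ 2 G Ω')
    (hFbij : Set.BijOn F Ω Ω')
    (hGF : ∀ x ∈ Ω, G (F x) = x) (hFG : ∀ y ∈ Ω', F (G y) = y)
    (hJ : ∀ x ∈ Ω, (jac F x).det ≠ 0)
    (A : (Fin n → ℝ) → Matrix (Fin n) (Fin n) ℝ)
    (hA : ∀ i j, ContDiffOn ℝ 1 (fun x => A x i j) Ω)
    (κ : (Fin n → ℝ) → ℝ) (hκ : ∀ x ∈ Ω, 0 < κ x)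
    (S : (Fin n → ℝ) → ℝ → ℝ)
    (ψ : (Fin n → ℝ) → ℝ → ℝ)
    (hψx : ∀ t : ℝ, 0 ≤ t → ContDiffOn ℝ 2 (fun x => ψ x t) Ω)
    (hψt : ∀ x ∈ Ω, ContDiffOn ℝ 1 (ψ x) (Set.Ici (0 : ℝ)))
    (hPDE : ∀ x ∈ Ω, ∀ t : ℝ, 0 ≤ t →
      (κ x)⁻¹ * derivWithin (ψ x) (Set.Ici (0 : ℝ)) t
        = pdiv (fun z => (A z).mulVec (pgrad (fun z' => ψ z' t) z)) x + S x t) :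
    ∀ y ∈ Ω', ∀ t : ℝ, 0 ≤ t →
      (|(jac F (G y)).det| * κ (G y))⁻¹ * derivWithin (fun s => ψ (G y) s) (Set.Ici (0 : ℝ)) t
        = pdiv (fun z => (pushf F G A z).mulVec (pgrad (fun z' => ψ (G z') t) z)) y
          + |(jac F (G y)).det|⁻¹ * S (G y) t := by
  intro y hy t ht
  have hG_mem : ∀ z ∈ Ω', G z ∈ Ω := by
    intro z hz
    obtain ⟨x, hx, rfl⟩ := hFbij.surjOn hz
    rwa [hGF x hx]
  have hx := hG_mem y hy
  have hGd : ∀ z ∈ Ω', DifferentiableAt ℝ G z := fun z hz =>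
    (hG.contDiffAt (hΩ'.mem_nhds hz)).differentiableAt two_ne_zero
  have hFc : ∀ x ∈ Ω, ContDiffAt ℝ 2 F x := fun x hx => hF.contDiffAt (hΩ.mem_nhds hx)
  have hψc : ∀ x ∈ Ω, ContDiffAt ℝ 2 (fun x => ψ x t) x := fun x hx =>
    (hψx t ht).contDiffAt (hΩ.mem_nhds hx)
  have hgrad : ∀ z ∈ Ω', (jac F (G z))ᵀ *ᵥ pgrad (fun z' => ψ (G z') t) z =
      pgrad (fun z' => ψ z' t) (G z) := by
    intro z hz
    have hz' := hG_mem z hz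
    have hd : DifferentiableAt ℝ (fun z' => ψ (G z') t) (F (G z)) := by
      rw [hFG z hz]
      exact ((hψc _ hz').differentiableAt two_ne_zero).comp z (hGd z hz)
    have h := pgrad_comp hd ((hFc _ hz').differentiableAt two_ne_zero)
    rw [hFG z hz] at h
    rw [← h]
    have he : (fun x => ψ (G (F x)) t) =ᶠ[nhds (G z)] fun x => ψ x t := by
      filter_upwards [hΩ.mem_nhds hz'] with x hx
      rw [hGF x hx]
    funext j
    simp only [pgrad, he.fderiv_eq]
  have hW : ∀ z ∈ Ω', pushf F G A z *ᵥ pgrad (fun z' => ψ (G z') t) z =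
      |(jac F (G z)).det|⁻¹ • (jac F (G z) *ᵥ (A (G z) *ᵥ pgrad (fun z' => ψ z' t) (G z))) := by
    intro z hz
    rw [pushf, Matrix.smul_mulVec, ← Matrix.mulVec_mulVec, ← Matrix.mulVec_mulVec, hgrad z hz]
  have hV : DifferentiableAt ℝ (fun x => A x *ᵥ pgrad (fun z' => ψ z' t) x) (G y) := by
    have hd : DifferentiableAt ℝ (fderiv ℝ (fun z => ψ z t)) (G y) :=
      ((hψc _ hx).fderiv_right (m := 1) (by norm_num)).differentiableAt one_ne_zero
    have hAd (i j) : DifferentiableAt ℝ (fun x => A x i j) (G y) :=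
      ((hA i j).contDiffAt (hΩ.mem_nhds hx)).differentiableAt one_ne_zero
    refine differentiableAt_pi.2 fun i => ?_
    simp only [Matrix.mulVec, dotProduct, pgrad]
    fun_prop
  have hdiv : pdiv (fun z => pushf F G A z *ᵥ pgrad (fun z' => ψ (G z') t) z) y =
      |(jac F (G y)).det|⁻¹ * pdiv (fun x => A x *ᵥ pgrad (fun z' => ψ z' t) x) (G y) := by
    rw [← pdiv_piola (hFc _ hx) (hGd y hy)
      (Filter.eventually_of_mem (hΩ'.mem_nhds hy) hFG) hV]
    refine Finset.sum_congr rfl fun j _ => ?_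
    rw [Filter.EventuallyEq.fderiv_eq]
    filter_upwards [hΩ'.mem_nhds hy] with z hz
    rw [hW z hz]
  rw [hdiv, ← mul_add, ← hPDE _ hx t ht, mul_inv, mul_assoc]
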